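/- There exist group isomorphisms φ_l : ℤ^{m(l)}/ℍ_{l,l−1}ℤ^{m(l−1)} → ℤ^{m(l−2)} (l ≥ 2) such that φ_{l+1} ∘ Î^t_{l,l+1} = (id_ℤ ⊕ J_{l−1,l−2}) ∘ φ_l for all l ≥ 3, where Î^t_{l,l+1} is the homomorphism induced by I_{l,l+1}^t and id_ℤ ⊕ J_{l−1,l−2} : ℤ ⊕ ℤ^{m(l−2)−1} → ℤ ⊕ ℤ^{m(l−1)−1} is the identity on the first summand and the map given by J_{l−1,l−2} on the second. Consequently the inductive limit of {ℤ^{m(l)}/ℍ_{l,l−1}ℤ^{m(l−1)}, Î^t_{l,l+1}} is isomorphic to ℤ ⊕ lim_{→}{J_{l+1,l} : ℤ^{m(l)−1} → ℤ^{m(l+1)−1}}. -/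

import Mathlib

noncomputable section

open Finset

/-- Admissibility for the golden-mean (Fibonacci) shift: words over the alphabet
`{1,2}` (coded as `Fin 2`, where `0` codes the letter `1` and `1` codes the letter `2`)
with no two consecutive letters equal to `2`. -/
def DyckAdm (l : ℕ) (w : Fin l → Fin 2) : Prop :=
  ∀ i j : Fin l, (j : ℕ) = (i : ℕ) + 1 → ¬(w i = 1 ∧ w j = 1)

instance (l : ℕ) : DecidablePred (DyckAdm l) := fun w => by
  unfold DyckAdm; infer_instance

/-- The set `W_l` of admissible words of length `l`. -/
def Wset (l : ℕ) : Finset (Fin l → Fin 2) := univ.filter (DyckAdm l)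

/-- `m(l)`, the number of admissible words of length `l`. -/
def mW (l : ℕ) : ℕ := (Wset l).card

/-- Lexicographic (from the left) strict order on words. -/
def lexLt (l : ℕ) (u w : Fin l → Fin 2) : Prop :=
  ∃ i : Fin l, (∀ j : Fin l, j < i → u j = w j) ∧ u i < w i

instance (l : ℕ) : DecidableRel (lexLt l) := fun u w => by
  unfold lexLt; infer_instance

/-- The (1-based) position of an admissible word in the lexicographic ordering of `W_l`,
identifying `W_l` with `{1, …, m(l)}`. -/
def rankW (l : ℕ) (w : Fin l → Fin 2) : ℕ :=
  1 + ((Wset l).filter (fun u => lexLt l u w)).card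

/-- The matrix `I_{l,l+1}` (1-based indices, entries outside `{1,…,m(l)} × {1,…,m(l+1)}`
are `0`): `I_{l,l+1}(w,w') = 1` iff the word `w'` with its last letter deleted is `w`. -/
def Imat (l : ℕ) : ℕ → ℕ → ℤ := fun i j =>
  if ∃ w ∈ Wset l, ∃ w' ∈ Wset (l + 1),
      rankW l w = i ∧ rankW (l + 1) w' = j ∧ (∀ k : Fin l, w k = w' k.castSucc)
  then 1 else 0

/-- The matrix `M_{l,l+1}` (1-based indices):
`M_{l,l+1}(w,w') = |{k ∈ {1,2} : w' = k·w}| + ε(w,w')`, where `ε(w,w') = 1` iff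
`F(w_1,w'_1) = 1` and `(w_2,…,w_l) = (w'_1,…,w'_{l-1})`; `M_{0,1} = [3 2]`.
(Here `F(a,b) = 0` iff both letters are `2`, i.e. both codes are `1`.) -/
def Mmat : ℕ → ℕ → ℕ → ℤ
  | 0, i, j => if i = 1 ∧ j = 1 then 3 else if i = 1 ∧ j = 2 then 2 else 0
  | (l + 1), i, j =>
      ∑ w ∈ Wset (l + 1), ∑ w' ∈ Wset (l + 2),
        if rankW (l + 1) w = i ∧ rankW (l + 2) w' = j then
          ((if (∀ t : Fin (l + 1), w' t.succ = w t) then (1 : ℤ) else 0) +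
           (if (¬(w 0 = 1 ∧ w' 0 = 1)) ∧
               (∀ t : Fin (l + 1), (t : ℕ) ≠ 0 →
                 w t = w' ⟨(t : ℕ) - 1,
                   (Nat.sub_le _ _).trans_lt (t.isLt.trans (Nat.lt_succ_self _))⟩)
            then (1 : ℤ) else 0))
        else 0

/-- The matrices `S_l` (of size `m(l-1) × m(l+1)`, 1-based indices):
`S_0 = [1 1]`, `S_1 = [1 1 1]`, `S_{l+2} = [[S_{l+1}, 0], [0, S_l]]` (block diagonal). -/
def Smat : ℕ → ℕ → ℕ → ℤ
  | 0, i, j => if i = 1 ∧ (1 ≤ j ∧ j ≤ 2) then 1 else 0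
  | 1, i, j => if i = 1 ∧ (1 ≤ j ∧ j ≤ 3) then 1 else 0
  | (l + 2), i, j =>
      if i ≤ mW l then (if j ≤ mW (l + 2) then Smat (l + 1) i j else 0)
      else (if j ≤ mW (l + 2) then 0 else Smat l (i - mW l) (j - mW (l + 2)))

/-- The matrix `𝔸_{l+1,l} = M_{l,l+1}^t − I_{l,l+1}^t` (1-based indices). -/
def AmatN (l : ℕ) : ℕ → ℕ → ℤ := fun i j => Mmat l j i - Imat l j i

/-- `𝔸_{l+1,l} = M_{l,l+1}^t − I_{l,l+1}^t` as an `m(l+1) × m(l)` matrix over `Fin` types. -/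
def AMat (l : ℕ) : Matrix (Fin (mW (l + 1))) (Fin (mW l)) ℤ :=
  fun i j => AmatN l ((i : ℕ) + 1) ((j : ℕ) + 1)

/-- The vectors `v_l ∈ ℤ^{m(l-1)}` (1-based entries): `v_1 = (-3)`, `v_2 = (-3,-3)`;
for `l ≥ 3`, `v_l(i) = -3` if `l ≡ 1, 2 (mod 4)` and `v_l(i) = 3` if `l ≡ 3, 0 (mod 4)`
for `1 ≤ i ≤ m(l-2)`, and `v_l(m(l-2)+i) = v_{l-2}(i) ∓ 4` (sign so as to decrease the
absolute value) for `1 ≤ i ≤ m(l-3)`. -/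
def vv : ℕ → ℕ → ℤ
  | 0, _ => 0
  | 1, i => if i = 1 then -3 else 0
  | 2, i => if 1 ≤ i ∧ i ≤ 2 then -3 else 0
  | (l + 3), i =>
      if 1 ≤ i ∧ i ≤ mW (l + 1) then
        (if (l + 3) % 4 = 1 ∨ (l + 3) % 4 = 2 then -3 else 3)
      else if mW (l + 1) < i ∧ i ≤ mW (l + 1) + mW l then
        (if 0 < vv (l + 1) (i - mW (l + 1)) then vv (l + 1) (i - mW (l + 1)) - 4
         else vv (l + 1) (i - mW (l + 1)) + 4)
      else 0

/-- The matrix `𝒩_{l+1,l}` (1-based indices, size `m(l+1) × m(l)`). -/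
def Nmat (l : ℕ) : ℕ → ℕ → ℤ := fun i j =>
  if 1 ≤ j ∧ j ≤ mW l ∧ 1 ≤ i ∧ i ≤ mW (l + 1) then
    (if i = j ∧ i < mW l then 1
     else if i = j ∧ i = mW l then 2
     else if mW l < i ∧ j = mW l then vv l (i - mW l)
     else 0)
  else 0

/-- The matrix `ℍ_{l+1,l}` (1-based indices, size `m(l+1) × m(l)`). -/
def Hmat (l : ℕ) : ℕ → ℕ → ℤ := fun i j =>
  if 1 ≤ j ∧ j ≤ mW l ∧ 1 ≤ i ∧ i ≤ mW (l + 1) then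
    (if i = j ∧ i < mW l then 1
     else if i = j ∧ i = mW l then 2
     else if mW l < i ∧ j = mW l then -1
     else 0)
  else 0

/-- `ℍ_{l+1,l}` as an additive map `ℤ^{m(l)} → ℤ^{m(l+1)}`. -/
def Hadd (l : ℕ) : (Fin (mW l) → ℤ) →+ (Fin (mW (l + 1)) → ℤ) :=
  (Matrix.mulVecLin
    (fun (i : Fin (mW (l + 1))) (j : Fin (mW l)) => Hmat l ((i : ℕ) + 1) ((j : ℕ) + 1))).toAddMonoidHom

/-- The vector `R_n = (2, -1, …, -1) ∈ ℤ^{n+1}`. -/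
def Rvec (n : ℕ) : Fin (n + 1) → ℤ := fun i => if i = 0 then 2 else -1

/-- `𝔸_{l+1,l} = M_{l,l+1}^t − I_{l,l+1}^t` as an additive map `ℤ^{m(l)} → ℤ^{m(l+1)}`. -/
def Aadd (l : ℕ) : (Fin (mW l) → ℤ) →+ (Fin (mW (l + 1)) → ℤ) :=
  (AMat l).mulVecLin.toAddMonoidHom

/-- `I_{l,l+1}^t` as an additive map `ℤ^{m(l)} → ℤ^{m(l+1)}`. -/
def ITadd (l : ℕ) : (Fin (mW l) → ℤ) →+ (Fin (mW (l + 1)) → ℤ) :=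
  (Matrix.mulVecLin
    (fun (i : Fin (mW (l + 1))) (j : Fin (mW l)) => Imat l ((j : ℕ) + 1) ((i : ℕ) + 1))).toAddMonoidHom

/-- `ITreach a b x y` holds iff `y` is obtained from `x` by applying the maps
`I^t_{a,a+1}, I^t_{a+1,a+2}, …, I^t_{b-1,b}` successively (`y = x` if `b = a`). -/
inductive ITreach : ∀ (a b : ℕ), (Fin (mW a) → ℤ) → (Fin (mW b) → ℤ) → Prop
  | refl (a : ℕ) (x : Fin (mW a) → ℤ) : ITreach a a x x
  | step {a b : ℕ} {x : Fin (mW a) → ℤ} {y : Fin (mW b) → ℤ} :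
      ITreach a b x y → ITreach a (b + 1) x (ITadd b y)

/-- The matrix `J_{l+1,l}` (1-based indices, size `(m(l+1)-1) × (m(l)-1)`):
its first row is zero and `J_{l+1,l}(i,j) = I_{l,l+1}(j+1, i+1)` for `i ≥ 2`. -/
def Jnat (l : ℕ) : ℕ → ℕ → ℤ := fun i j =>
  if i ≤ 1 ∨ j = 0 then 0 else Imat l (j + 1) (i + 1)

/-- `J_{l+1,l}` as an additive map `ℤ^{m(l)-1} → ℤ^{m(l+1)-1}`. -/
def Jhom (l : ℕ) : (Fin (mW l - 1) → ℤ) →+ (Fin (mW (l + 1) - 1) → ℤ) :=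
  (Matrix.mulVecLin
    (fun (i : Fin (mW (l + 1) - 1)) (j : Fin (mW l - 1)) =>
      Jnat l ((i : ℕ) + 1) ((j : ℕ) + 1))).toAddMonoidHom

/-- The composition `J_{l+j,l+j-1} ∘ ⋯ ∘ J_{l+1,l} : ℤ^{m(l)-1} → ℤ^{m(l+j)-1}`. -/
def Jpush (l : ℕ) : ∀ j : ℕ, (Fin (mW l - 1) → ℤ) →+ (Fin (mW (l + j) - 1) → ℤ)
  | 0 => AddMonoidHom.id _
  | (j + 1) => (Jhom (l + j)).comp (Jpush l j)

/-- `id_ℤ ⊕ J_{n+1,n} : ℤ ⊕ ℤ^{m(n)-1} → ℤ ⊕ ℤ^{m(n+1)-1}`, written as a map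
`ℤ^{m(n)} → ℤ^{m(n+1)}` (the `ℤ` summand being the `0`-th coordinate). -/
def idJ (n : ℕ) : (Fin (mW n) → ℤ) →+ (Fin (mW (n + 1)) → ℤ) :=
  (Matrix.mulVecLin
    (fun (i : Fin (mW (n + 1))) (j : Fin (mW n)) =>
      if (i : ℕ) = 0 ∧ (j : ℕ) = 0 then 1 else Jnat n (i : ℕ) (j : ℕ))).toAddMonoidHom

lemma dyckAdm_cons_zero {l : ℕ} (w : Fin l → Fin 2) :
    DyckAdm (l + 1) (Fin.cons 0 w) ↔ DyckAdm l w := by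
  simp [DyckAdm, Fin.forall_fin_succ (n := l)]

lemma dyckAdm_cons_one_cons {l : ℕ} (a : Fin 2) (w : Fin l → Fin 2) :
    DyckAdm (l + 2) (Fin.cons 1 (Fin.cons a w)) ↔ a = 0 ∧ DyckAdm l w := by
  rcases Fin.exists_fin_two.1 ⟨a, rfl⟩ with rfl | rfl <;>
  simp [DyckAdm, Fin.forall_fin_succ (n := l), Fin.forall_fin_succ (n := l + 1)]

lemma lexLt_cons {l : ℕ} (a b : Fin 2) (u w : Fin l → Fin 2) :
    lexLt (l + 1) (Fin.cons a u) (Fin.cons b w) ↔ a < b ∨ a = b ∧ lexLt l u w := by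
  simp [lexLt, Fin.exists_fin_succ (n := l), Fin.forall_fin_succ (n := l)]
  tauto

lemma lexLt_irrefl {l : ℕ} (w : Fin l → Fin 2) : ¬ lexLt l w w := by
  simp [lexLt]

lemma one_le_rankW (l : ℕ) (w : Fin l → Fin 2) : 1 ≤ rankW l w := Nat.le_add_right _ _

lemma rankW_le {l : ℕ} {w : Fin l → Fin 2} (hw : w ∈ Wset l) : rankW l w ≤ mW l := by
  have : ((Wset l).filter (fun u => lexLt l u w)).card < (Wset l).card :=
    card_lt_card (filter_ssubset.2 ⟨w, hw, lexLt_irrefl w⟩)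
  unfold rankW mW
  omega

/-- Prefixing the letter `1`. -/
def consOne {l : ℕ} : (Fin l → Fin 2) ↪ (Fin (l + 1) → Fin 2) :=
  ⟨fun w => Fin.cons 0 w, Fin.cons_right_injective (α := fun _ => Fin 2) 0⟩

/-- Prefixing the letters `21`. -/
def consTwoOne {l : ℕ} : (Fin l → Fin 2) ↪ (Fin (l + 2) → Fin 2) :=
  consOne.trans ⟨fun w => Fin.cons 1 w, Fin.cons_right_injective (α := fun _ => Fin 2) 1⟩

lemma mem_Wset_succ_succ {l : ℕ} (w : Fin (l + 2) → Fin 2) :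
    w ∈ Wset (l + 2) ↔
      (∃ u ∈ Wset (l + 1), consOne u = w) ∨ ∃ u ∈ Wset l, consTwoOne u = w := by
  constructor
  · intro hw
    obtain ⟨a, v, rfl⟩ : ∃ (a : Fin 2) (v : Fin (l + 1) → Fin 2), w = Fin.cons a v :=
      ⟨w 0, Fin.tail w, (Fin.cons_self_tail w).symm⟩
    obtain ⟨b, u, rfl⟩ : ∃ (b : Fin 2) (u : Fin l → Fin 2), v = Fin.cons b u :=
      ⟨v 0, Fin.tail v, (Fin.cons_self_tail v).symm⟩
    rcases Fin.exists_fin_two.1 ⟨a, rfl⟩ with rfl | rfl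
    · left
      refine ⟨Fin.cons b u, ?_, rfl⟩
      simpa [Wset, dyckAdm_cons_zero] using hw
    · right
      obtain ⟨rfl, h⟩ : b = 0 ∧ DyckAdm l u := by
        simpa [Wset, dyckAdm_cons_one_cons] using hw
      exact ⟨u, by simpa [Wset] using h, rfl⟩
  · rintro (⟨u, hu, rfl⟩ | ⟨u, hu, rfl⟩)
    · simpa [Wset, consOne, dyckAdm_cons_zero] using hu
    · simpa [Wset, consOne, consTwoOne, dyckAdm_cons_one_cons] using hu

lemma Wset_succ_succ (l : ℕ) :
    Wset (l + 2) = (Wset (l + 1)).map consOne ∪ (Wset l).map consTwoOne := by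
  ext w
  simp only [mem_Wset_succ_succ, mem_union, mem_map]

lemma disjoint_map_consOne (l : ℕ) (s : Finset (Fin (l + 1) → Fin 2))
    (t : Finset (Fin l → Fin 2)) : Disjoint (s.map consOne) (t.map consTwoOne) := by
  rw [disjoint_left]
  intro w hw hw'
  obtain ⟨u, -, rfl⟩ := mem_map.1 hw
  obtain ⟨v, -, hv⟩ := mem_map.1 hw'
  have := congrFun hv 0
  simp [consOne, consTwoOne] at this

lemma mW_succ_succ (l : ℕ) : mW (l + 2) = mW (l + 1) + mW l := by
  rw [mW, Wset_succ_succ, card_union_of_disjoint (disjoint_map_consOne l _ _), card_map,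
    card_map, mW, mW]

lemma rankW_consOne {l : ℕ} (w : Fin (l + 1) → Fin 2) :
    rankW (l + 2) (consOne w) = rankW (l + 1) w := by
  rw [rankW, Wset_succ_succ, filter_union, filter_map, filter_map,
    card_union_of_disjoint (disjoint_map_consOne l _ _), card_map, card_map, rankW]
  simp [Function.comp_def, consOne, consTwoOne, lexLt_cons]

lemma rankW_consTwoOne {l : ℕ} (w : Fin l → Fin 2) :
    rankW (l + 2) (consTwoOne w) = mW (l + 1) + rankW l w := by
  rw [rankW, Wset_succ_succ, filter_union, filter_map, filter_map,
    card_union_of_disjoint (disjoint_map_consOne l _ _), card_map, card_map, rankW]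
  simp [Function.comp_def, consOne, consTwoOne, lexLt_cons, mW]
  omega

/-- The entry of `I_{l,l+1}` at `(i, j)` is nonzero: the `j`-th word extends the `i`-th. -/
def Extends (l i j : ℕ) : Prop :=
  ∃ w ∈ Wset l, ∃ w' ∈ Wset (l + 1),
    rankW l w = i ∧ rankW (l + 1) w' = j ∧ (∀ k : Fin l, w k = w' k.castSucc)

open Classical in
lemma Imat_eq_ite (l i j : ℕ) : Imat l i j = if Extends l i j then 1 else 0 := by
  unfold Imat Extends
  congr

open Classical in
lemma Imat_congr {l i j l' i' j' : ℕ} (h : Extends l i j ↔ Extends l' i' j') :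
    Imat l i j = Imat l' i' j' := by
  rw [Imat_eq_ite, Imat_eq_ite]
  exact if_congr h rfl rfl

lemma Extends.bounds {l i j : ℕ} (h : Extends l i j) :
    (1 ≤ i ∧ i ≤ mW l) ∧ 1 ≤ j ∧ j ≤ mW (l + 1) := by
  obtain ⟨w, hw, w', hw', rfl, rfl, -⟩ := h
  exact ⟨⟨one_le_rankW _ _, rankW_le hw⟩, one_le_rankW _ _, rankW_le hw'⟩

lemma extends_succ_succ (l i j : ℕ) :
    Extends (l + 2) i j ↔ Extends (l + 1) i j ∨
      ∃ a b, i = mW (l + 1) + a ∧ j = mW (l + 2) + b ∧ Extends l a b := by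
  constructor
  · rintro ⟨w, hw, w', hw', rfl, rfl, h⟩
    rw [mem_Wset_succ_succ] at hw hw'
    rcases hw with ⟨u, hu, rfl⟩ | ⟨u, hu, rfl⟩ <;> rcases hw' with ⟨v, hv, rfl⟩ | ⟨v, hv, rfl⟩
    · refine Or.inl ⟨u, hu, v, hv, (rankW_consOne u).symm, (rankW_consOne v).symm, fun k => ?_⟩
      simpa [consOne] using h k.succ
    · simpa [consOne, consTwoOne] using h 0
    · simpa [consOne, consTwoOne] using h 0
    · refine Or.inr ⟨_, _, rankW_consTwoOne u, rankW_consTwoOne v, u, hu, v, hv, rfl, rfl,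
        fun k => ?_⟩
      simpa [consOne, consTwoOne] using h k.succ.succ
  · rintro (⟨u, hu, v, hv, rfl, rfl, h⟩ | ⟨_, _, rfl, rfl, u, hu, v, hv, rfl, rfl, h⟩)
    · refine ⟨consOne u, (mem_Wset_succ_succ _).2 (Or.inl ⟨u, hu, rfl⟩), consOne v,
        (mem_Wset_succ_succ _).2 (Or.inl ⟨v, hv, rfl⟩), rankW_consOne u, rankW_consOne v, ?_⟩
      intro k
      induction k using Fin.cases with
      | zero => simp [consOne]
      | succ k => simpa [consOne] using h k
    · refine ⟨consTwoOne u, (mem_Wset_succ_succ _).2 (Or.inr ⟨u, hu, rfl⟩), consTwoOne v,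
        (mem_Wset_succ_succ _).2 (Or.inr ⟨v, hv, rfl⟩), rankW_consTwoOne u,
        rankW_consTwoOne v, ?_⟩
      intro k
      induction k using Fin.cases with
      | zero => simp [consOne, consTwoOne]
      | succ k =>
        induction k using Fin.cases with
        | zero => simp [consOne, consTwoOne]
        | succ k => simpa [consOne, consTwoOne] using h k

lemma mW_zero : mW 0 = 1 := by decide

lemma mW_one : mW 1 = 2 := by decide

lemma mW_pos (l : ℕ) : 0 < mW l := by
  induction l using Nat.twoStepInduction with
  | zero => simp [mW_zero]
  | one => simp [mW_one]
  | more l h _ => rw [mW_succ_succ]; omega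

lemma two_le_mW_succ (l : ℕ) : 2 ≤ mW (l + 1) := by
  induction l with
  | zero => simp [mW_one]
  | succ l h => rw [mW_succ_succ]; omega

lemma Imat_succ_succ_of_le {l i j : ℕ} (hi : i ≤ mW (l + 1)) :
    Imat (l + 2) i j = Imat (l + 1) i j := by
  refine Imat_congr ?_
  rw [extends_succ_succ, or_iff_left_iff_imp]
  rintro ⟨a, b, rfl, rfl, h⟩
  have := h.bounds
  omega

lemma Imat_eq_zero {l i j : ℕ} (h : mW l < i ∨ mW (l + 1) < j) : Imat l i j = 0 := by
  rw [Imat_eq_ite, if_neg]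
  intro h'
  have := h'.bounds
  omega

lemma Imat_succ_succ_eq_zero {l i j : ℕ} (hi : mW (l + 1) < i) (hj : j ≤ mW (l + 2)) :
    Imat (l + 2) i j = 0 := by
  rw [Imat_eq_ite, if_neg]
  rw [extends_succ_succ]
  rintro (h | ⟨a, b, rfl, rfl, h⟩) <;> have := h.bounds <;> omega

lemma Imat_succ_succ_add (l a b : ℕ) :
    Imat (l + 2) (mW (l + 1) + (a + 1)) (mW (l + 2) + (b + 1)) = Imat l (a + 1) (b + 1) := by
  refine Imat_congr ?_
  rw [extends_succ_succ]
  constructor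
  · rintro (h | ⟨a', b', h1, h2, h⟩)
    · have := h.bounds; omega
    · obtain rfl : a' = a + 1 := by omega
      obtain rfl : b' = b + 1 := by omega
      exact h
  · exact fun h => Or.inr ⟨_, _, rfl, rfl, h⟩

lemma Imat_last_col (l i : ℕ) (hi : 1 ≤ i) (hi' : i ≤ mW l) :
    Imat l i (mW (l + 1)) = if i = mW l then 1 else 0 := by
  induction l using Nat.twoStepInduction generalizing i with
  | zero =>
    rw [mW_zero] at *
    obtain rfl : i = 1 := by omega
    decide
  | one =>
    rw [mW_one] at *
    interval_cases i <;> decide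
  | more l ih _ =>
    have := mW_succ_succ l
    have := mW_succ_succ (l + 1)
    have := mW_pos l
    have := mW_pos (l + 1)
    rcases le_or_gt i (mW (l + 1)) with h | h
    · rw [Imat_succ_succ_of_le h, Imat_eq_zero, if_neg (by omega)]
      right
      change mW (l + 2) < mW (l + 3)
      simp only [add_assoc, Nat.reduceAdd] at *
      omega
    · obtain ⟨a, rfl⟩ : ∃ a, i = mW (l + 1) + (a + 1) := ⟨i - mW (l + 1) - 1, by omega⟩
      obtain ⟨b, hb⟩ : ∃ b, mW (l + 1) = b + 1 := ⟨mW (l + 1) - 1, by omega⟩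
      have h2 : mW (l + 2 + 1) = mW (l + 2) + (b + 1) := by
        rw [← hb]; exact mW_succ_succ (l + 1)
      rw [h2, Imat_succ_succ_add, ← hb, ih _ (by omega) (by omega)]
      congr 1
      simp only [eq_iff_iff]
      omega

lemma Imat_first_cols (l i j : ℕ) (hi : 1 ≤ i) (hi' : i ≤ mW l) (hj : 1 ≤ j) (hj' : j ≤ 2) :
    Imat l i j = if i = 1 then 1 else 0 := by
  induction l using Nat.twoStepInduction generalizing i with
  | zero =>
    rw [mW_zero] at *
    obtain rfl : i = 1 := by omega
    interval_cases j <;> decide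
  | one =>
    rw [mW_one] at *
    interval_cases i <;> interval_cases j <;> decide
  | more l _ ih =>
    have := two_le_mW_succ l
    have := two_le_mW_succ (l + 1)
    rcases le_or_gt i (mW (l + 1)) with h | h
    · rw [Imat_succ_succ_of_le h, ih i hi h]
    · rw [Imat_succ_succ_eq_zero h (by omega), if_neg (by omega)]

lemma sum_Imat_col (l j : ℕ) (hj : j < mW (l + 1)) :
    ∑ i ∈ range (mW l), Imat l (i + 1) (j + 1) = 1 := by
  induction l using Nat.twoStepInduction generalizing j with
  | zero =>
    simp only [mW_zero, zero_add, mW_one] at *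
    interval_cases j <;> decide
  | one =>
    have h2 : mW (1 + 1) = 3 := by decide
    rw [h2] at hj
    rw [mW_one]
    interval_cases j <;> decide
  | more l ih1 ih2 =>
    have h3 : mW (l + 2 + 1) = mW (l + 2) + mW (l + 1) := mW_succ_succ (l + 1)
    rw [mW_succ_succ, sum_range_add]
    rcases lt_or_ge j (mW (l + 2)) with h | h
    · rw [sum_eq_zero (s := range (mW l)), add_zero, ← ih2 j h]
      · refine sum_congr rfl fun i hi => Imat_succ_succ_of_le ?_
        simp at hi; omega
      · intro i hi
        exact Imat_succ_succ_eq_zero (by omega) (by omega)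
    · obtain ⟨b, rfl⟩ : ∃ b, j = mW (l + 2) + b := ⟨j - mW (l + 2), by omega⟩
      rw [sum_eq_zero (s := range (mW (l + 1))), zero_add, ← ih1 b (by omega)]
      · exact sum_congr rfl fun i _ => Imat_succ_succ_add l i b
      · intro i hi
        simp at hi
        rw [Imat_succ_succ_of_le (by omega)]
        exact Imat_eq_zero (by right; change mW (l + 2) < _; omega)

/-- Extension by zero of a vector in `ℤ^N` to a sequence. -/
def extendZero {N : ℕ} (x : Fin N → ℤ) (i : ℕ) : ℤ := if h : i < N then x ⟨i, h⟩ else 0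

lemma extendZero_of_lt {N : ℕ} (x : Fin N → ℤ) {i : ℕ} (h : i < N) :
    extendZero x i = x ⟨i, h⟩ := dif_pos h

@[simp] lemma extendZero_val {N : ℕ} (x : Fin N → ℤ) (i : Fin N) : extendZero x i = x i :=
  dif_pos i.2

@[simp] lemma extendZero_zero {N : ℕ} (i : ℕ) : extendZero (0 : Fin N → ℤ) i = 0 := by
  simp [extendZero]

@[simp] lemma extendZero_add {N : ℕ} (x y : Fin N → ℤ) (i : ℕ) :
    extendZero (x + y) i = extendZero x i + extendZero y i := by
  unfold extendZero
  split <;> simp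

lemma sum_mul_eq_sum_extendZero {N : ℕ} (f : ℕ → ℤ) (x : Fin N → ℤ) :
    ∑ j : Fin N, f j * x j = ∑ j ∈ range N, f j * extendZero x j := by
  rw [← Fin.sum_univ_eq_sum_range (fun j => f j * extendZero x j)]
  simp

lemma ITadd_apply (l : ℕ) (x : Fin (mW l) → ℤ) (i : Fin (mW (l + 1))) :
    ITadd l x i = ∑ j ∈ range (mW l), Imat l (j + 1) (i + 1) * extendZero x j :=
  sum_mul_eq_sum_extendZero (fun j => Imat l (j + 1) (i + 1)) x

lemma Jhom_apply (l : ℕ) (x : Fin (mW l - 1) → ℤ) (i : Fin (mW (l + 1) - 1)) :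
    Jhom l x i = ∑ j ∈ range (mW l - 1), Jnat l (i + 1) (j + 1) * extendZero x j :=
  sum_mul_eq_sum_extendZero (fun j => Jnat l (i + 1) (j + 1)) x

lemma idJ_apply (n : ℕ) (x : Fin (mW n) → ℤ) (i : Fin (mW (n + 1))) :
    idJ n x i = ∑ j ∈ range (mW n),
      (if (i : ℕ) = 0 ∧ j = 0 then 1 else Jnat n i j) * extendZero x j :=
  sum_mul_eq_sum_extendZero (fun j => if (i : ℕ) = 0 ∧ j = 0 then 1 else Jnat n i j) x

lemma Hadd_apply (l : ℕ) (y : Fin (mW l) → ℤ) (i : Fin (mW (l + 1))) :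
    Hadd l y i = if (i : ℕ) + 1 < mW l then extendZero y i
      else if (i : ℕ) + 1 = mW l then 2 * extendZero y i else - extendZero y (mW l - 1) := by
  have h : Hadd l y i = ∑ j ∈ range (mW l), Hmat l (i + 1) (j + 1) * extendZero y j :=
    sum_mul_eq_sum_extendZero (fun j => Hmat l (i + 1) (j + 1)) y
  have hl := mW_pos l
  have hi := i.2
  rw [h]
  split_ifs with h1 h2
  · rw [sum_eq_single (i : ℕ)]
    · rw [Hmat, if_pos (by omega), if_pos (by omega), one_mul]
    · intro j hj hji
      rw [mem_range] at hj
      rw [Hmat, if_pos (by omega), if_neg (by omega), if_neg (by omega), if_neg (by omega),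
        zero_mul]
    · simp; omega
  · rw [sum_eq_single (i : ℕ)]
    · rw [Hmat, if_pos (by omega), if_neg (by omega), if_pos (by omega)]
    · intro j hj hji
      rw [mem_range] at hj
      rw [Hmat, if_pos (by omega), if_neg (by omega), if_neg (by omega), if_neg (by omega),
        zero_mul]
    · simp; omega
  · rw [sum_eq_single (mW l - 1)]
    · rw [Hmat, if_pos (by omega), if_neg (by omega), if_neg (by omega), if_pos (by omega),
        neg_one_mul]
    · intro j hj hji
      rw [mem_range] at hj
      rw [Hmat, if_pos (by omega), if_neg (by omega), if_neg (by omega), if_neg (by omega),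
        zero_mul]
    · simp; omega

/-- The map `ℤ^{m(n+2)} → ℤ^{m(n)}` with kernel the image of `ℍ_{n+2,n+1}`. -/
def cokerHom (n : ℕ) : (Fin (mW (n + 2)) → ℤ) →+ (Fin (mW n) → ℤ) where
  toFun x k :=
    if (k : ℕ) = 0 then extendZero x (mW (n + 1) - 1) + 2 * extendZero x (mW (n + 1))
    else extendZero x (mW (n + 1) + k) - extendZero x (mW (n + 1))
  map_zero' := by ext; simp
  map_add' x y := by
    ext
    simp only [extendZero_add, Pi.add_apply]
    split_ifs <;> ring

lemma cokerHom_apply (n : ℕ) (x : Fin (mW (n + 2)) → ℤ) (k : Fin (mW n)) :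
    cokerHom n x k =
      if (k : ℕ) = 0 then extendZero x (mW (n + 1) - 1) + 2 * extendZero x (mW (n + 1))
      else extendZero x (mW (n + 1) + k) - extendZero x (mW (n + 1)) := rfl

lemma cokerHom_surjective (n : ℕ) : Function.Surjective (cokerHom n) := by
  intro v
  have hm := mW_succ_succ n
  have h1 := mW_pos (n + 1)
  have h0 := mW_pos n
  refine ⟨fun i => if (i : ℕ) = mW (n + 1) - 1 then extendZero v 0 else
    if (i : ℕ) ≤ mW (n + 1) then 0 else extendZero v (i - mW (n + 1)), ?_⟩
  ext k
  have hk := k.2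
  rw [cokerHom_apply, extendZero_of_lt _ (show mW (n + 1) - 1 < mW (n + 2) by omega),
    extendZero_of_lt _ (show mW (n + 1) < mW (n + 2) by omega),
    extendZero_of_lt _ (show mW (n + 1) + k < mW (n + 2) by omega)]
  simp only [if_true, le_refl]
  rw [if_neg (show ¬ mW (n + 1) = mW (n + 1) - 1 by omega)]
  split_ifs with h2
  · rw [← h2]; simp
  · omega
  · omega
  · simp

lemma range_Hadd_eq_ker (n : ℕ) : (Hadd (n + 1)).range = (cokerHom n).ker := by
  have hm := mW_succ_succ n
  have h1 := mW_pos (n + 1)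
  have h0 := mW_pos n
  ext x
  rw [AddMonoidHom.mem_range, AddMonoidHom.mem_ker]
  constructor
  · rintro ⟨y, rfl⟩
    have hlast : extendZero (Hadd (n + 1) y) (mW (n + 1) - 1) =
        2 * extendZero y (mW (n + 1) - 1) := by
      rw [extendZero_of_lt _ (show mW (n + 1) - 1 < mW (n + 2) by omega), Hadd_apply,
        if_neg (by rw [Nat.sub_add_cancel h1]; exact lt_irrefl _),
        if_pos (Nat.sub_add_cancel h1)]
    have hadd : ∀ k < mW n, extendZero (Hadd (n + 1) y) (mW (n + 1) + k) =
        - extendZero y (mW (n + 1) - 1) := by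
      intro k hk
      rw [extendZero_of_lt _ (show mW (n + 1) + k < mW (n + 2) by omega), Hadd_apply,
        if_neg (show ¬ mW (n + 1) + k + 1 < mW (n + 1) by omega),
        if_neg (show mW (n + 1) + k + 1 ≠ mW (n + 1) by omega)]
    ext k
    have hfirst := hadd 0 h0
    rw [add_zero] at hfirst
    rw [cokerHom_apply, hlast, hadd k k.2, hfirst]
    simp
  · intro hx
    have hx0 : extendZero x (mW (n + 1) - 1) + 2 * extendZero x (mW (n + 1)) = 0 := by
      have := congrFun hx ⟨0, h0⟩
      simpa [cokerHom_apply] using this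
    have hxk : ∀ k < mW n, extendZero x (mW (n + 1) + k) = extendZero x (mW (n + 1)) := by
      intro k hk
      rcases eq_or_ne k 0 with rfl | h
      · rfl
      · have := congrFun hx ⟨k, hk⟩
        simp only [cokerHom_apply, h, if_false, Pi.zero_apply] at this
        omega
    refine ⟨fun i => if (i : ℕ) + 1 < mW (n + 1) then extendZero x i
      else - extendZero x (mW (n + 1)), ?_⟩
    ext i
    have hi : (i : ℕ) < mW (n + 2) := i.2
    rw [Hadd_apply, ← extendZero_val x i]
    rcases lt_trichotomy ((i : ℕ) + 1) (mW (n + 1)) with h | h | h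
    · rw [if_pos h, extendZero_of_lt _ (by omega)]
      simp [h]
    · rw [if_neg (by omega), if_pos h, extendZero_of_lt _ (show (i : ℕ) < mW (n + 1) by omega),
        show (i : ℕ) = mW (n + 1) - 1 by omega]
      rw [if_neg (by omega)]
      omega
    · rw [if_neg (by omega), if_neg (by omega),
        extendZero_of_lt _ (show mW (n + 1) - 1 < mW (n + 1) by omega)]
      rw [if_neg (by rw [Nat.sub_add_cancel h1]; exact lt_irrefl _), neg_neg,
        ← hxk (i - mW (n + 1)) (by omega)]
      congr 1
      omega

lemma sum_range_eq_sum_pred_add {N : ℕ} (f : ℕ → ℤ) (hN : 0 < N) :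
    ∑ j ∈ range N, f j = ∑ j ∈ range (N - 1), f (j + 1) + f 0 := by
  obtain ⟨p, rfl⟩ : ∃ p, N = p + 1 := ⟨N - 1, by omega⟩
  rw [sum_range_succ', Nat.add_sub_cancel]

lemma cokerHom_ITadd (n : ℕ) (x : Fin (mW (n + 2)) → ℤ) :
    cokerHom (n + 1) (ITadd (n + 2) x) = idJ n (cokerHom n x) := by
  have hm : mW (n + 2) = mW (n + 1) + mW n := mW_succ_succ n
  have hm' : mW (n + 2 + 1) = mW (n + 2) + mW (n + 1) := mW_succ_succ (n + 1)
  have h1 := two_le_mW_succ n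
  have h0 := mW_pos n
  have hlast : extendZero (ITadd (n + 2) x) (mW (n + 2) - 1) = extendZero x (mW (n + 1) - 1) := by
    rw [extendZero_of_lt _ (by omega), ITadd_apply, sum_eq_single (mW (n + 1) - 1)]
    · simp only
      rw [Nat.sub_add_cancel (by omega), Nat.sub_add_cancel (by omega),
        Imat_succ_succ_of_le le_rfl, Imat_last_col _ _ (by omega) le_rfl]
      simp
    · intro j hj hne
      rw [mem_range] at hj
      simp only
      rw [Nat.sub_add_cancel (by omega)]
      rcases le_or_gt (j + 1) (mW (n + 1)) with h | h
      · rw [Imat_succ_succ_of_le h, Imat_last_col _ _ (by omega) h, if_neg (by omega), zero_mul]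
      · rw [Imat_succ_succ_eq_zero h le_rfl, zero_mul]
    · simp; omega
  have hsplit : ∀ f : ℕ → ℤ, ∑ j ∈ range (mW (n + 2)), f j =
      ∑ j ∈ range (mW (n + 1)), f j + ∑ a ∈ range (mW n), f (mW (n + 1) + a) := by
    intro f
    rw [hm, sum_range_add]
  have hadd : ∀ b < mW (n + 1), extendZero (ITadd (n + 2) x) (mW (n + 2) + b) =
      ∑ a ∈ range (mW n), Imat n (a + 1) (b + 1) * extendZero x (mW (n + 1) + a) := by
    intro b hb
    rw [extendZero_of_lt _ (by omega), ITadd_apply, hsplit, sum_eq_zero, zero_add]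
    · exact sum_congr rfl fun a _ => congrArg (· * _) (Imat_succ_succ_add n a b)
    · intro j hj
      rw [mem_range] at hj
      rw [Imat_succ_succ_of_le (by omega), Imat_eq_zero, zero_mul]
      right
      change mW (n + 2) < mW (n + 2) + b + 1
      omega
  have hsucc : ∀ a, Imat n (a + 1 + 1) 1 = 0 ∧ Imat n (a + 1 + 1) 2 = 0 := by
    intro a
    rcases le_or_gt (a + 1 + 1) (mW n) with h | h
    · rw [Imat_first_cols _ _ _ (by omega) h (by omega) (by omega),
        Imat_first_cols _ _ _ (by omega) h (by omega) (by omega)]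
      simp
    · exact ⟨Imat_eq_zero (Or.inl h), Imat_eq_zero (Or.inl h)⟩
  ext b
  rw [cokerHom_apply, idJ_apply]
  change (if (b : ℕ) = 0 then extendZero (ITadd (n + 2) x) (mW (n + 2) - 1) +
    2 * extendZero (ITadd (n + 2) x) (mW (n + 2)) else
    extendZero (ITadd (n + 2) x) (mW (n + 2) + b) -
      extendZero (ITadd (n + 2) x) (mW (n + 2))) = _
  have hfirst : extendZero (ITadd (n + 2) x) (mW (n + 2)) = extendZero x (mW (n + 1)) := by
    have := hadd 0 (by omega)
    rw [add_zero] at this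
    rw [this, sum_range_eq_sum_pred_add _ h0, sum_eq_zero, zero_add]
    · simp only [zero_add]
      rw [Imat_first_cols _ _ _ le_rfl h0 le_rfl (by omega)]
      simp
    · intro a _
      rw [(hsucc a).1, zero_mul]
  rw [hlast, hfirst, sum_range_eq_sum_pred_add _ h0]
  have hJ0 : ∀ i, Jnat n i 0 = 0 := fun i => by simp [Jnat]
  rcases eq_or_ne (b : ℕ) 0 with hb | hb
  · simp only [hb, if_true, true_and, Nat.succ_ne_zero, if_false]
    rw [sum_eq_zero, zero_add, one_mul, extendZero_of_lt _ h0, cokerHom_apply]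
    · simp
    · intro a _
      simp [Jnat]
  · simp only [hb, if_false, false_and, hJ0, zero_mul, add_zero]
    have hb' := b.2
    have hcol := sum_Imat_col n b b.2
    rw [hadd b b.2, sum_range_eq_sum_pred_add _ h0]
    rw [sum_range_eq_sum_pred_add _ h0] at hcol
    have key : ∀ a ∈ range (mW n - 1), Jnat n b (a + 1) * extendZero (cokerHom n x) (a + 1) =
        Imat n (a + 1 + 1) (b + 1) * extendZero x (mW (n + 1) + (a + 1)) -
          Imat n (a + 1 + 1) (b + 1) * extendZero x (mW (n + 1)) := by
      intro a ha
      rw [mem_range] at ha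
      rw [extendZero_of_lt _ (show a + 1 < mW n by omega), cokerHom_apply, ← mul_sub]
      simp only [Nat.succ_ne_zero, if_false]
      rcases eq_or_ne (b : ℕ) 1 with h | h
      · rw [h, (hsucc a).2]
        simp [Jnat]
      · rw [Jnat, if_neg (by omega)]
    rw [sum_congr rfl key, sum_sub_distrib, ← sum_mul]
    rw [eq_sub_of_add_eq hcol]
    simp only [zero_add, add_zero]
    ring

/-- The isomorphism `ℤ^{m(n+2)} / ℍ_{n+2,n+1} ℤ^{m(n+1)} ≃ ℤ^{m(n)}`. -/
def cokerEquiv (n : ℕ) :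
    ((Fin (mW (n + 2)) → ℤ) ⧸ (Hadd (n + 1)).range) ≃+ (Fin (mW n) → ℤ) :=
  (QuotientAddGroup.quotientAddEquivOfEq (range_Hadd_eq_ker n)).trans
    (QuotientAddGroup.quotientKerEquivOfSurjective _ (cokerHom_surjective n))

lemma cokerEquiv_mk (n : ℕ) (x : Fin (mW (n + 2)) → ℤ) :
    cokerEquiv n (QuotientAddGroup.mk' (Hadd (n + 1)).range x) = cokerHom n x := rfl

lemma cokerEquiv_ITadd (n : ℕ) (x : Fin (mW (n + 2)) → ℤ) :
    cokerEquiv (n + 1) (QuotientAddGroup.mk' (Hadd (n + 2)).range (ITadd (n + 2) x)) =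
      idJ n (cokerEquiv n (QuotientAddGroup.mk' (Hadd (n + 1)).range x)) := by
  rw [cokerEquiv_mk, cokerEquiv_mk, cokerHom_ITadd]

/-- The decomposition `ℤ^{m(l)} ≃ ℤ ⊕ ℤ^{m(l)-1}` splitting off the first coordinate. -/
def headTail (l : ℕ) : (Fin (mW l) → ℤ) ≃+ ℤ × (Fin (mW l - 1) → ℤ) where
  toFun v := (extendZero v 0, fun i => extendZero v (i + 1))
  invFun p i := if (i : ℕ) = 0 then p.1 else extendZero p.2 (i - 1)
  left_inv v := by
    ext i
    have hi := i.2
    simp only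
    split_ifs with h
    · rw [← h, extendZero_val]
    · rw [extendZero_of_lt _ (by omega)]
      simp only
      rw [Nat.sub_add_cancel (by omega), extendZero_val]
  right_inv p := by
    have hl := mW_pos l
    ext i
    · simp [extendZero, hl]
    · have hi := i.2
      simp only
      rw [extendZero_of_lt _ (by omega)]
      simp
  map_add' v w := by ext <;> simp

lemma headTail_idJ (n : ℕ) (v : Fin (mW n) → ℤ) :
    headTail (n + 1) (idJ n v) = ((headTail n v).1, Jhom n (headTail n v).2) := by
  have h0 := mW_pos n
  have h1 := mW_pos (n + 1)
  ext i
  · change extendZero (idJ n v) 0 = extendZero v 0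
    rw [extendZero_of_lt _ h1, idJ_apply, sum_eq_single 0]
    · simp
    · intro j _ hj
      simp [hj, Jnat]
    · simp [h0.ne']
  · have hi := i.2
    change extendZero (idJ n v) (i + 1) = Jhom n (headTail n v).2 i
    rw [extendZero_of_lt _ (by omega), idJ_apply, Jhom_apply, sum_range_eq_sum_pred_add _ h0]
    simp only [Nat.succ_ne_zero, false_and, if_false]
    rw [show Jnat n (i + 1) 0 = 0 by simp [Jnat], zero_mul, add_zero]
    refine sum_congr rfl fun j hj => ?_
    rw [extendZero_of_lt (headTail n v).2 (mem_range.1 hj)]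
    rfl

/-- Two abelian groups exhausted by the images of the same sequence of groups, compatibly with
transition maps and with the same kernels, are isomorphic. -/
lemma nonempty_addEquiv_of_same_kernels {A : ℕ → Type*} [∀ n, AddCommGroup (A n)]
    {T T' : Type*} [AddCommGroup T] [AddCommGroup T'] (f : ∀ n, A n → A (n + 1))
    (θ : ∀ n, A n →+ T) (θ' : ∀ n, A n →+ T')
    (hθ : ∀ n x, θ (n + 1) (f n x) = θ n x) (hθ' : ∀ n x, θ' (n + 1) (f n x) = θ' n x)
    (hsurj : ∀ t, ∃ n x, θ n x = t) (hsurj' : ∀ t, ∃ n x, θ' n x = t)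
    (hker : ∀ n x, θ n x = 0 ↔ θ' n x = 0) : Nonempty (T ≃+ T') := by
  have push : ∀ n k, n ≤ k → ∀ x : A n, ∃ z : A k, θ k z = θ n x ∧ θ' k z = θ' n x := by
    intro n k hnk x
    induction k, hnk using Nat.le_induction with
    | base => exact ⟨x, rfl, rfl⟩
    | succ k _ ih =>
      obtain ⟨z, hz, hz'⟩ := ih
      exact ⟨f k z, by rw [hθ, hz], by rw [hθ', hz']⟩
  have key : ∀ n m (x : A n) (y : A m), θ n x = θ m y → θ' n x = θ' m y := by
    intro n m x y h
    obtain ⟨z, hz, hz'⟩ := push n (max n m) (le_max_left _ _) x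
    obtain ⟨w, hw, hw'⟩ := push m (max n m) (le_max_right _ _) y
    have := (hker (max n m) (z - w)).1 (by rw [map_sub, hz, hw, h, sub_self])
    rw [← hz', ← hw']
    exact sub_eq_zero.1 (by rw [← map_sub, this])
  choose N X hX using hsurj
  let e : T →+ T' := AddMonoidHom.mk' (fun t => θ' (N t) (X t)) fun s t => by
    obtain ⟨z, hz, hz'⟩ := push (N s) (max (N s) (N t)) (le_max_left _ _) (X s)
    obtain ⟨w, hw, hw'⟩ := push (N t) (max (N s) (N t)) (le_max_right _ _) (X t)
    rw [← hz', ← hw', ← map_add]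
    exact key _ _ _ _ (by rw [hX, map_add, hz, hw, hX, hX])
  refine ⟨AddEquiv.ofBijective e ⟨(injective_iff_map_eq_zero e).2 fun t ht => ?_, fun t' => ?_⟩⟩
  · rw [← hX t]
    exact (hker _ _).2 ht
  · obtain ⟨n, x, rfl⟩ := hsurj' t'
    exact ⟨θ n x, key _ _ _ _ (hX _)⟩

lemma ITreach.eq_of_invariant {Z : Type*} {k : ℕ} (F : ∀ a, (Fin (mW a) → ℤ) → Z)
    (hF : ∀ a, k ≤ a → ∀ x, F (a + 1) (ITadd a x) = F a x) {a b : ℕ} {x : Fin (mW a) → ℤ}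
    {y : Fin (mW b) → ℤ} (h : ITreach a b x y) (ha : k ≤ a) : k ≤ b ∧ F b y = F a x := by
  induction h with
  | refl => exact ⟨ha, rfl⟩
  | step _ ih =>
    obtain ⟨h1, h2⟩ := ih
    exact ⟨by omega, by rw [hF _ h1, h2]⟩

lemma Jpush_invariant {Z : Type*} (K : ∀ l, (Fin (mW l - 1) → ℤ) → Z)
    (hK : ∀ l v, K (l + 1) (Jhom l v) = K l v) (l j : ℕ) (v : Fin (mW l - 1) → ℤ) :
    K (l + j) (Jpush l j v) = K l v := by
  induction j with
  | zero => rfl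
  | succ j ih => rw [← ih]; exact hK (l + j) _

/-- The splitting `ℤ^{m(n+2)} / ℍ_{n+2,n+1} ℤ^{m(n+1)} ≃ ℤ ⊕ ℤ^{m(n)-1}`. -/
def cokerSplit (n : ℕ) :
    ((Fin (mW (n + 2)) → ℤ) ⧸ (Hadd (n + 1)).range) ≃+ ℤ × (Fin (mW n - 1) → ℤ) :=
  (cokerEquiv n).trans (headTail n)

lemma cokerSplit_ITadd (n : ℕ) (x : Fin (mW (n + 2)) → ℤ) :
    cokerSplit (n + 1) (QuotientAddGroup.mk' (Hadd (n + 2)).range (ITadd (n + 2) x)) =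
      ((cokerSplit n (QuotientAddGroup.mk' (Hadd (n + 1)).range x)).1,
        Jhom n (cokerSplit n (QuotientAddGroup.mk' (Hadd (n + 1)).range x)).2) :=
  (congrArg (headTail (n + 1)) (cokerEquiv_ITadd n x)).trans (headTail_idJ n _)

/-- Extension of a family of maps on `ℤ^{m(l)-1}`, `l ≥ 1`, by zero at `l = 0`. -/
def extendFamily {G : Type*} [AddCommGroup G] (ψ : ∀ n : ℕ, (Fin (mW (n + 1) - 1) → ℤ) →+ G) :
    ∀ l : ℕ, (Fin (mW l - 1) → ℤ) →+ G
  | 0 => 0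
  | n + 1 => ψ n

lemma eq_zero_of_level_zero (v : Fin (mW 0 - 1) → ℤ) : v = 0 := by
  ext i
  have hi := i.2
  have h0 := mW_zero
  omega

lemma extendFamily_Jhom {G : Type*} [AddCommGroup G]
    (ψ : ∀ n : ℕ, (Fin (mW (n + 1) - 1) → ℤ) →+ G)
    (hψ : ∀ n x, ψ (n + 1) (Jhom (n + 1) x) = ψ n x) (l : ℕ) (v : Fin (mW l - 1) → ℤ) :
    extendFamily ψ (l + 1) (Jhom l v) = extendFamily ψ l v := by
  cases l with
  | zero => rw [eq_zero_of_level_zero v, map_zero, map_zero, map_zero]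
  | succ n => exact hψ n v

/-- The maps `ℤ^{m(n+2)} → ℤ ⊕ G` induced by the splittings of the cokernels. -/
def toProd {G : Type*} [AddCommGroup G] (ψ : ∀ n : ℕ, (Fin (mW (n + 1) - 1) → ℤ) →+ G) (n : ℕ) :
    (Fin (mW (n + 2)) → ℤ) →+ ℤ × G :=
  (((AddMonoidHom.id ℤ).prodMap (extendFamily ψ n)).comp (cokerSplit n).toAddMonoidHom).comp
    (QuotientAddGroup.mk' (Hadd (n + 1)).range)

lemma toProd_apply {G : Type*} [AddCommGroup G] (ψ : ∀ n : ℕ, (Fin (mW (n + 1) - 1) → ℤ) →+ G)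
    (n : ℕ) (x : Fin (mW (n + 2)) → ℤ) :
    toProd ψ n x = ((cokerSplit n (QuotientAddGroup.mk' (Hadd (n + 1)).range x)).1,
      extendFamily ψ n (cokerSplit n (QuotientAddGroup.mk' (Hadd (n + 1)).range x)).2) := rfl

lemma toProd_ITadd {G : Type*} [AddCommGroup G] (ψ : ∀ n : ℕ, (Fin (mW (n + 1) - 1) → ℤ) →+ G)
    (hψ : ∀ n x, ψ (n + 1) (Jhom (n + 1) x) = ψ n x) (n : ℕ) (x : Fin (mW (n + 2)) → ℤ) :
    toProd ψ (n + 1) (ITadd (n + 2) x) = toProd ψ n x := by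
  rw [toProd_apply, toProd_apply, cokerSplit_ITadd, extendFamily_Jhom ψ hψ]

lemma limit_cokernel_iso {T G : Type*} [AddCommGroup T] [AddCommGroup G]
    (θ : ∀ n : ℕ, ((Fin (mW (n + 2)) → ℤ) ⧸ (Hadd (n + 1)).range) →+ T)
    (ψ : ∀ n : ℕ, (Fin (mW (n + 1) - 1) → ℤ) →+ G)
    (hθ : ∀ (n : ℕ) (x : Fin (mW (n + 2)) → ℤ),
      θ (n + 1) (QuotientAddGroup.mk' (Hadd (n + 2)).range (ITadd (n + 2) x)) =
        θ n (QuotientAddGroup.mk' (Hadd (n + 1)).range x))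
    (hθsurj : ∀ t : T, ∃ (n : ℕ) (x : Fin (mW (n + 2)) → ℤ),
      θ n (QuotientAddGroup.mk' (Hadd (n + 1)).range x) = t)
    (hθker : ∀ (n : ℕ) (x : Fin (mW (n + 2)) → ℤ),
      θ n (QuotientAddGroup.mk' (Hadd (n + 1)).range x) = 0 →
        ∃ (b : ℕ) (y : Fin (mW (b + 2)) → ℤ),
          ITreach (n + 2) (b + 2) x y ∧ y ∈ (Hadd (b + 1)).range)
    (hψ : ∀ (n : ℕ) (x : Fin (mW (n + 1) - 1) → ℤ), ψ (n + 1) (Jhom (n + 1) x) = ψ n x)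
    (hψsurj : ∀ g : G, ∃ (n : ℕ) (x : Fin (mW (n + 1) - 1) → ℤ), ψ n x = g)
    (hψker : ∀ (n : ℕ) (x : Fin (mW (n + 1) - 1) → ℤ),
      ψ n x = 0 → ∃ j : ℕ, Jpush (n + 1) j x = 0) :
    Nonempty (T ≃+ (ℤ × G)) := by
  refine nonempty_addEquiv_of_same_kernels (fun n => ITadd (n + 2))
    (fun n => (θ n).comp (QuotientAddGroup.mk' (Hadd (n + 1)).range)) (toProd ψ)
    hθ (toProd_ITadd ψ hψ) hθsurj ?_ fun n x => ⟨fun h => ?_, fun h => ?_⟩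
  · rintro ⟨c, g⟩
    obtain ⟨n, v, rfl⟩ := hψsurj g
    obtain ⟨x, hx⟩ := QuotientAddGroup.mk'_surjective _ ((cokerSplit (n + 1)).symm (c, v))
    refine ⟨n + 1, x, ?_⟩
    rw [toProd_apply, hx, AddEquiv.apply_symm_apply]
    rfl
  · obtain ⟨b, y, hreach, hy⟩ := hθker n x h
    let F : ∀ a, (Fin (mW a) → ℤ) → ℤ × G
      | 0, _ => 0
      | 1, _ => 0
      | a + 2, z => toProd ψ a z
    have hF : ∀ a, 2 ≤ a → ∀ z, F (a + 1) (ITadd a z) = F a z := by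
      intro a ha z
      obtain ⟨a, rfl⟩ := Nat.exists_eq_add_of_le' ha
      exact toProd_ITadd ψ hψ a z
    have hb : toProd ψ b y = toProd ψ n x :=
      (hreach.eq_of_invariant F hF (Nat.le_add_left 2 n)).2
    have hmk : QuotientAddGroup.mk' (Hadd (b + 1)).range y = 0 :=
      (QuotientAddGroup.eq_zero_iff y).2 hy
    rw [← hb, toProd_apply, hmk]
    simp
  · let K : ∀ l, (Fin (mW l - 1) → ℤ) → T := fun l v => θ l ((cokerSplit l).symm (0, v))
    have hK : ∀ l v, K (l + 1) (Jhom l v) = K l v := by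
      intro l v
      obtain ⟨z, hz⟩ := QuotientAddGroup.mk'_surjective _ ((cokerSplit l).symm (0, v))
      have hsplit := cokerSplit_ITadd l z
      rw [hz, AddEquiv.apply_symm_apply] at hsplit
      change θ (l + 1) ((cokerSplit (l + 1)).symm (0, Jhom l v)) =
        θ l ((cokerSplit l).symm (0, v))
      rw [← hsplit, AddEquiv.symm_apply_apply, hθ, hz]
    have hK0 : ∀ l, K l 0 = 0 := fun l =>
      (congrArg (θ l) (map_zero (cokerSplit l).symm)).trans (map_zero (θ l))
    rw [toProd_apply, Prod.mk_eq_zero] at h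
    change θ n (QuotientAddGroup.mk' (Hadd (n + 1)).range x) = 0
    set q := QuotientAddGroup.mk' (Hadd (n + 1)).range x
    have hq : θ n q = K n (cokerSplit n q).2 := by
      change _ = θ n ((cokerSplit n).symm (0, (cokerSplit n q).2))
      rw [← h.1, Prod.mk.eta, AddEquiv.symm_apply_apply]
    rw [hq]
    clear_value q
    cases n with
    | zero => rw [eq_zero_of_level_zero (cokerSplit 0 q).2, hK0]
    | succ n =>
      obtain ⟨j, hj⟩ := hψker n _ h.2
      rw [← Jpush_invariant K hK (n + 1) j, hj, hK0]

/-- there are isomorphisms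
`φ_l : ℤ^{m(l)}/ℍ_{l,l-1}ℤ^{m(l-1)} → ℤ^{m(l-2)}` (for `l ≥ 2`, here `l = n + 2`)
with `φ_{l+1} ∘ Î^t_{l,l+1} = (id_ℤ ⊕ J_{l-1,l-2}) ∘ φ_l` for all `l ≥ 3`; consequently
any direct limit of the system `{ℤ^{m(l)}/ℍ_{l,l-1}ℤ^{m(l-1)}, Î^t}` is isomorphic to
`ℤ ⊕ G` for any direct limit `G` of the system `{J_{l+1,l} : ℤ^{m(l)-1} → ℤ^{m(l+1)-1}}`. -/
theorem coker_H_limit_iso :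
    ∃ φ : ∀ n : ℕ,
        ((Fin (mW (n + 2)) → ℤ) ⧸ (Hadd (n + 1)).range) ≃+ (Fin (mW n) → ℤ),
      (∀ n : ℕ, 1 ≤ n → ∀ x : Fin (mW (n + 2)) → ℤ,
          φ (n + 1) (QuotientAddGroup.mk' (Hadd (n + 2)).range (ITadd (n + 2) x)) =
            idJ n (φ n (QuotientAddGroup.mk' (Hadd (n + 1)).range x)))
      ∧
      (∀ (T : Type) [AddCommGroup T]
          (θ : ∀ n : ℕ, ((Fin (mW (n + 2)) → ℤ) ⧸ (Hadd (n + 1)).range) →+ T)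
          (G : Type) [AddCommGroup G]
          (ψ : ∀ n : ℕ, (Fin (mW (n + 1) - 1) → ℤ) →+ G),
        -- `θ` presents `T` as the inductive limit of the system `{coker ℍ, Î^t}`:
        (∀ (n : ℕ) (x : Fin (mW (n + 2)) → ℤ),
            θ (n + 1) (QuotientAddGroup.mk' (Hadd (n + 2)).range (ITadd (n + 2) x)) =
              θ n (QuotientAddGroup.mk' (Hadd (n + 1)).range x)) →
        (∀ t : T, ∃ (n : ℕ) (x : Fin (mW (n + 2)) → ℤ),
            θ n (QuotientAddGroup.mk' (Hadd (n + 1)).range x) = t) →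
        (∀ (n : ℕ) (x : Fin (mW (n + 2)) → ℤ),
            θ n (QuotientAddGroup.mk' (Hadd (n + 1)).range x) = 0 →
            ∃ (b : ℕ) (y : Fin (mW (b + 2)) → ℤ),
              ITreach (n + 2) (b + 2) x y ∧ y ∈ (Hadd (b + 1)).range) →
        -- `ψ` presents `G` as the inductive limit of the system `{J_{l+1,l}}_{l ≥ 1}`:
        (∀ (n : ℕ) (x : Fin (mW (n + 1) - 1) → ℤ), ψ (n + 1) (Jhom (n + 1) x) = ψ n x) →
        (∀ g : G, ∃ (n : ℕ) (x : Fin (mW (n + 1) - 1) → ℤ), ψ n x = g) →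
        (∀ (n : ℕ) (x : Fin (mW (n + 1) - 1) → ℤ),
            ψ n x = 0 → ∃ j : ℕ, Jpush (n + 1) j x = 0) →
        Nonempty (T ≃+ (ℤ × G))) := by
  exact ⟨cokerEquiv, fun n _ => cokerEquiv_ITadd n, fun T _ θ G _ ψ => limit_cokernel_iso θ ψ⟩
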